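/- Let I ⊆ R be an R-homogeneous ideal and let J = φ(I)S be its standardization. Then the Krull dimension of S/J equals dim(S) − codim(I) = 2p² − (p² − dim(R/I)) = p² + dim(R/I). -/

import Mathlib

open MvPolynomial

/-- The standardization map `φ : R = k[x_{ij}] → S = k[w_{ij}, z_{ij}]`, `x_{ij} ↦ w_{ij}z_{ij}`.
Here the variables of `S` are indexed by `(Fin p × Fin p) ⊕ (Fin p × Fin p)`, where
`Sum.inl (i,j)` is `w_{ij}` and `Sum.inr (i,j)` is `z_{ij}`. -/
noncomputable def stdMap (k : Type*) [CommSemiring k] (p : ℕ) :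
    MvPolynomial (Fin p × Fin p) k →ₐ[k]
      MvPolynomial ((Fin p × Fin p) ⊕ (Fin p × Fin p)) k :=
  MvPolynomial.aeval fun q : Fin p × Fin p => X (Sum.inl q) * X (Sum.inr q)

/-- The weight function giving the `ℤ^p ⊕ ℤ^p`-grading of `R = k[x_{ij}]`,
where `deg (x_{ij}) = e_i ⊕ e_j`. -/
def wtR (p : ℕ) : Fin p × Fin p → (Fin p → ℕ) × (Fin p → ℕ) :=
  fun q => (Pi.single q.1 1, Pi.single q.2 1)

/-- An ideal `I ⊆ R = k[x_{ij}]` is homogeneous with respect to the `ℤ^p ⊕ ℤ^p`-grading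
with `deg (x_{ij}) = e_i ⊕ e_j` iff it contains all the multihomogeneous components of
each of its elements. -/
def IsMultigradedHomogeneous {k : Type*} [CommSemiring k] {p : ℕ}
    (I : Ideal (MvPolynomial (Fin p × Fin p) k)) : Prop :=
  ∀ f ∈ I, ∀ d : (Fin p → ℕ) × (Fin p → ℕ),
    MvPolynomial.weightedHomogeneousComponent (wtR p) d f ∈ I

section Integral

variable {A B : Type*} [CommRing A] [CommRing B] {f : A →+* B}

lemma RingHom.IsIntegral.ringKrullDim_le (hf : f.IsIntegral) :
    ringKrullDim B ≤ ringKrullDim A := by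
  algebraize [f]
  exact Order.krullDim_le_of_strictMono (PrimeSpectrum.comap (algebraMap A B))
    fun P Q h ↦ Ideal.IsIntegral.comap_lt_comap (I := P.asIdeal) (J := Q.asIdeal) h

lemma RingHom.IsIntegral.ringKrullDim_eq (hf : f.IsIntegral)
    (hsurj : Function.Surjective (PrimeSpectrum.comap f)) :
    ringKrullDim B = ringKrullDim A := by
  refine hf.ringKrullDim_le.antisymm (iSup_le fun l ↦ ?_)
  algebraize [f]
  obtain ⟨P, hP⟩ := hsurj l.head
  have : P.asIdeal.LiesOver l.head.asIdeal := ⟨by rw [← hP]; rfl⟩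
  obtain ⟨L, hL, -⟩ := Ideal.exists_ltSeries_of_hasGoingUp l P.asIdeal
  exact hL ▸ Order.LTSeries.length_le_krullDim L

lemma RingHom.IsIntegral.quotientMap_map (hf : f.IsIntegral) (I : Ideal A) :
    (Ideal.quotientMap (I.map f) f Ideal.le_comap_map).IsIntegral := by
  refine RingHom.IsIntegral.tower_top (Ideal.Quotient.mk I) _ ?_
  rw [Ideal.quotientMap_comp_mk]
  exact RingHom.IsIntegral.trans _ _ hf
    (RingHom.isIntegral_of_surjective _ Ideal.Quotient.mk_surjective)

/-- An injective integral extension preserves the dimension of the quotient by any ideal. -/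
lemma RingHom.IsIntegral.ringKrullDim_quotient_map (hf : f.IsIntegral)
    (hinj : Function.Injective f) (I : Ideal A) :
    ringKrullDim (B ⧸ I.map f) = ringKrullDim (A ⧸ I) := by
  refine (hf.quotientMap_map I).ringKrullDim_eq fun p ↦ ?_
  obtain ⟨q, hq⟩ := hf.comap_surjective hinj (p.comap (Ideal.Quotient.mk I))
  have hle : I.map f ≤ q.asIdeal := by
    rw [Ideal.map_le_iff_le_comap, ← PrimeSpectrum.comap_asIdeal, hq, PrimeSpectrum.comap_asIdeal]
    exact (Ideal.mk_ker (I := I)).ge.trans (Ideal.ker_le_comap _)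
  have hmem : q ∈ Set.range (PrimeSpectrum.comap (Ideal.Quotient.mk (I.map f))) := by
    rw [range_comap_of_surjective _ _ Ideal.Quotient.mk_surjective, Ideal.mk_ker]
    exact hle
  obtain ⟨q', rfl⟩ := hmem
  refine ⟨q', PrimeSpectrum.comap_injective_of_surjective _ Ideal.Quotient.mk_surjective ?_⟩
  rw [← hq, ← PrimeSpectrum.comap_comp_apply, ← PrimeSpectrum.comap_comp_apply,
    Ideal.quotientMap_comp_mk]

/-- An integral ring homomorphism from a domain to a ring of the same finite dimension is
injective. -/
lemma RingHom.IsIntegral.injective_of_ringKrullDim_eq [IsDomain A] (hf : f.IsIntegral) {n : ℕ}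
    (hA : ringKrullDim A = n) (hB : ringKrullDim B = n) : Function.Injective f := by
  rw [injective_iff_map_eq_zero]
  intro a ha
  by_contra ha0
  have hle : ringKrullDim B ≤ ringKrullDim f.range :=
    RingHom.IsIntegral.ringKrullDim_le (f := f.range.subtype)
      (RingHom.IsIntegral.tower_top f.rangeRestrict _ hf)
  have hlt : ringKrullDim f.range + 1 ≤ ringKrullDim A :=
    ringKrullDim_succ_le_of_surjective f.rangeRestrict f.rangeRestrict_surjective
      (mem_nonZeroDivisors_of_ne_zero ha0) (Subtype.ext ha)
  have h : ringKrullDim B + 1 ≤ ringKrullDim A := (add_le_add_left hle 1).trans hlt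
  rw [hA, hB] at h
  exact absurd h (by exact_mod_cast Nat.not_succ_le_self n)

end Integral

section SumProd

variable (k ι : Type*) [CommRing k]

/-- The map `k[x][u] → k[w, z]` sending `x i` to `w i * z i` and `u i` to `w i - z i`. -/
noncomputable def prodDiffMap :
    MvPolynomial ι (MvPolynomial ι k) →+* MvPolynomial (ι ⊕ ι) k :=
  eval₂Hom (aeval fun i ↦ X (Sum.inl i) * X (Sum.inr i) :
      MvPolynomial ι k →ₐ[k] MvPolynomial (ι ⊕ ι) k)
    fun i ↦ X (Sum.inl i) - X (Sum.inr i)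

lemma prodDiffMap_isIntegral : (prodDiffMap k ι).IsIntegral := by
  have hx (i : ι) : prodDiffMap k ι (C (X i)) = X (Sum.inl i) * X (Sum.inr i) := by
    simp [prodDiffMap]
  have hu (i : ι) : prodDiffMap k ι (X i) = X (Sum.inl i) - X (Sum.inr i) := by
    simp [prodDiffMap]
  intro s
  induction s using MvPolynomial.induction_on with
  | C a => simpa [prodDiffMap] using (prodDiffMap k ι).isIntegralElem_map (x := C (C a))
  | add p q hp hq => exact hp.add _ hq
  | mul_X p i hp =>
    refine hp.mul _ ?_
    rcases i with i | i
    · refine ⟨.X ^ 2 - .C (X i) * .X - .C (C (X i)), by monicity!, ?_⟩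
      simp only [Polynomial.eval₂_sub, Polynomial.eval₂_mul, Polynomial.eval₂_pow,
        Polynomial.eval₂_X, Polynomial.eval₂_C, hx, hu]
      ring
    · refine ⟨.X ^ 2 + .C (X i) * .X - .C (C (X i)), by monicity!, ?_⟩
      simp only [Polynomial.eval₂_sub, Polynomial.eval₂_add, Polynomial.eval₂_mul,
        Polynomial.eval₂_pow, Polynomial.eval₂_X, Polynomial.eval₂_C, hx, hu]
      ring

lemma prodDiffMap_injective (k ι : Type*) [Field k] [Finite ι] :
    Function.Injective (prodDiffMap k ι) := by
  refine (prodDiffMap_isIntegral k ι).injective_of_ringKrullDim_eq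
    (n := Nat.card ι + Nat.card ι) ?_ ?_ <;>
  simp [MvPolynomial.ringKrullDim_of_isNoetherianRing]

/-- The ideal of `k[w, z]` generated by the image of an ideal `I` of `k[x]` under
`x i ↦ w i * z i` has a quotient of dimension `dim k[x]/I` plus the number of variables `x`. -/
lemma ringKrullDim_quotient_map_prod {k ι : Type*} [Field k] [Finite ι]
    (I : Ideal (MvPolynomial ι k)) :
    ringKrullDim (MvPolynomial (ι ⊕ ι) k ⧸ I.map (aeval fun i ↦ X (Sum.inl i) * X (Sum.inr i) :
      MvPolynomial ι k →ₐ[k] MvPolynomial (ι ⊕ ι) k)) =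
      ringKrullDim (MvPolynomial ι k ⧸ I) + Nat.card ι := by
  have hmap : I.map (aeval fun i ↦ X (Sum.inl i) * X (Sum.inr i) :
      MvPolynomial ι k →ₐ[k] MvPolynomial (ι ⊕ ι) k) = (I.map C).map (prodDiffMap k ι) := by
    rw [Ideal.map_map, prodDiffMap, eval₂Hom_comp_C]
    rfl
  rw [hmap, (prodDiffMap_isIntegral k ι).ringKrullDim_quotient_map (prodDiffMap_injective k ι),
    ← ringKrullDim_eq_of_ringEquiv (quotientEquivQuotientMvPolynomial (σ := ι) I).toRingEquiv,
    MvPolynomial.ringKrullDim_of_isNoetherianRing]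

end SumProd

/-- For the standardization `J = φ(I)S` of an `R`-homogeneous ideal `I`, we have
`dim S/J = dim S - codim I = 2p² - (p² - dim R/I) = p² + dim R/I`. -/
theorem dim_quotient_standardization (p : ℕ) (hp : 1 ≤ p) (k : Type*) [Field k]
    (I : Ideal (MvPolynomial (Fin p × Fin p) k))
    (hI : IsMultigradedHomogeneous I) :
    ringKrullDim (MvPolynomial ((Fin p × Fin p) ⊕ (Fin p × Fin p)) k ⧸
        Ideal.map (stdMap k p) I) =
      (p ^ 2 : ℕ) + ringKrullDim (MvPolynomial (Fin p × Fin p) k ⧸ I) := by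
  rw [stdMap, ringKrullDim_quotient_map_prod, add_comm]
  simp [sq]
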